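/- arXiv:2406.06036 — 2 statements merged into one kernel-verified Lean document; each statement's English description precedes it below -/
import Mathlib

section
/- Let λ be a partition of n in which every even part has even multiplicity, written as having m_{2i} copies of each even part 2i (m_{2i} even) and m_{2j+1} copies of each odd part 2j+1. Then the number of permutations x ∈ S_n with x² of cycle type λ equals ∏_{i≥1} (m_{2i}−1)!!·(2i)^{m_{2i}/2} · ∏_{j≥0} o_{2j+1}(m_{2j+1}), where o_r(m) = Σ_{k=0}^{⌊m/2⌋} C(m,2k)·(2k−1)!!·r^k. -/
/-- `o_r(m) = ∑_{k=0}^{⌊m/2⌋} C(m,2k) (2k-1)!! r^k`. -/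
def oFun (r m : ℕ) : ℕ :=
  ∑ k ∈ Finset.range (m / 2 + 1),
    m.choose (2 * k) * Nat.doubleFactorial (2 * k - 1) * r ^ k

/-- Square roots of a permutation correspond to self-maps whose second iterate is it. -/
noncomputable def sqrtPermEquiv {α : Type*} (w : Equiv.Perm α) :
    {x : Equiv.Perm α // x ^ 2 = w} ≃ {g : α → α // ∀ a, g (g a) = w a} where
  toFun x := ⟨x.1, fun a => by
    have h := Equiv.congr_fun x.2 a
    rwa [sq] at h⟩
  invFun g := ⟨Equiv.ofBijective g.1 ⟨fun a b h => w.injective (by rw [← g.2, ← g.2, h]),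
      fun b => ⟨g.1 (w.symm b), by simp [g.2]⟩⟩, by
    ext a
    rw [sq]
    exact g.2 a⟩
  left_inv x := by ext; rfl
  right_inv g := rfl

/-- Square roots preserving the fibres of a map decompose as families of square roots
on the fibres. -/
def sqrtFiberEquiv {α ι : Type*} (w : α → α) (f : α → ι)
    (hf : ∀ g : α → α, (∀ a, g (g a) = w a) → ∀ a, f (g a) = f a) :
    {g : α → α // ∀ a, g (g a) = w a} ≃
      ∀ i, {y : {a // f a = i} → {a // f a = i} // ∀ p, (y (y p) : α) = w p} where
  toFun g i := ⟨fun p => ⟨g.1 p, by rw [hf g.1 g.2, p.2]⟩, fun p => g.2 p⟩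
  invFun y := ⟨fun a => ((y (f a)).1 ⟨a, rfl⟩).1, fun a => by
    have key : ∀ i b (hb : f b = i), (((y (f b)).1 ⟨b, rfl⟩).1 : α) = ((y i).1 ⟨b, hb⟩).1 := by
      rintro i b rfl; rfl
    beta_reduce
    rw [key (f a) _ ((y (f a)).1 ⟨a, rfl⟩).2]
    exact (y (f a)).2 ⟨a, rfl⟩⟩
  left_inv g := rfl
  right_inv y := by
    funext i
    ext ⟨a, rfl⟩
    rfl

/-- Square roots preserve the lengths of cycles. -/
theorem minimalPeriod_eq_of_sqrt {α : Type*} (w : Equiv.Perm α) (g : α → α)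
    (hg : ∀ a, g (g a) = w a) (a : α) :
    Function.minimalPeriod w (g a) = Function.minimalPeriod w a := by
  have hinj : Function.Injective g := fun a b h => w.injective (by rw [← hg, ← hg, h])
  have hc : Function.Commute g w := fun b => by rw [← hg, ← hg]
  rw [Function.minimalPeriod_eq_minimalPeriod_iff]
  intro k
  have := (hc.iterate_right k) a
  simp only [Function.IsPeriodicPt, Function.IsFixedPt]
  rw [← this, hinj.eq_iff]

/-- A permutation all of whose orbits have size `r` is a union of translations of `ZMod r`. -/
theorem exists_equiv_prod_zmod {P : Type*} [Finite P] (u : Equiv.Perm P) (r : ℕ) [NeZero r]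
    (h : ∀ p, Function.minimalPeriod u p = r) :
    ∃ (I : Type) (_ : Finite I) (e : I × ZMod r ≃ P), ∀ i a, e (i, a + 1) = u (e (i, a)) := by
  classical
  obtain ⟨N, ⟨eQ⟩⟩ := Finite.exists_equiv_fin (Quotient (Equiv.Perm.SameCycle.setoid u))
  have hz : ∀ (k l : ℤ) (p : P), (u ^ k) p = (u ^ l) p ↔ (k : ZMod r) = l := by
    intro k l p
    have h1 := MulAction.zpow_smul_eq_iff_minimalPeriod_dvd (a := u) (b := p) (n := k - l)
    have h2 : Function.minimalPeriod (fun x => u • x) p = r := h p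
    rw [h2, Equiv.Perm.smul_def] at h1
    rw [← sub_eq_zero (a := (k : ZMod r)), ← Int.cast_sub, ZMod.intCast_zmod_eq_zero_iff_dvd, ← h1,
      sub_eq_neg_add, zpow_add, Equiv.Perm.mul_apply, zpow_neg, Equiv.Perm.inv_eq_iff_eq]
  let Φ : Fin N × ZMod r → P := fun x => (u ^ (x.2.val : ℤ)) (eQ.symm x.1).out
  have hΦ : ∀ i (k : ℤ), Φ (i, k) = (u ^ k) (eQ.symm i).out := by
    intro i k
    simp only [Φ]
    rw [hz]
    simp
  have hclass : ∀ x, eQ ⟦Φ x⟧ = x.1 := by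
    rintro ⟨i, a⟩
    rw [← Equiv.eq_symm_apply]
    conv_rhs => rw [← (eQ.symm i).out_eq]
    apply Quotient.sound
    exact Equiv.Perm.SameCycle.symm ⟨_, rfl⟩
  have hinj : Function.Injective Φ := by
    rintro ⟨i, a⟩ ⟨j, b⟩ hab
    obtain rfl : i = j := by
      have h1 := hclass (i, a)
      rwa [hab, hclass, eq_comm] at h1
    simp only [Φ] at hab
    rw [hz] at hab
    simpa using hab
  have hsurj : Function.Surjective Φ := by
    intro p
    obtain ⟨k, hk⟩ : u.SameCycle (⟦p⟧ : Quotient (Equiv.Perm.SameCycle.setoid u)).out p :=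
      Quotient.exact (s := Equiv.Perm.SameCycle.setoid u) (Quotient.out_eq _)
    exact ⟨(eQ ⟦p⟧, (k : ZMod r)), by rw [hΦ]; simpa using hk⟩
  refine ⟨Fin N, inferInstance, Equiv.ofBijective Φ (show Function.Bijective Φ from ⟨hinj, hsurj⟩),
    fun i a => ?_⟩
  obtain ⟨k, rfl⟩ := ZMod.intCast_surjective a
  have h1 := hΦ i (k + 1)
  push_cast at h1
  simp only [Equiv.ofBijective_apply]
  rw [h1, hΦ, ← Equiv.Perm.mul_apply, ← zpow_one_add, add_comm]

/-- The data determining a square root of the unit translation of `I × ZMod r`: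
the image of each `(i, 0)`. -/
abbrev ShiftSqrt (r : ℕ) (I : Type*) : Type _ :=
  {h : I → I × ZMod r // ∀ i, h (h i).1 = (i, 1 - (h i).2)}

theorem sqrt_shift_apply {I : Type*} {r : ℕ} (G : I × ZMod r → I × ZMod r)
    (hG : ∀ p, G (G p) = (p.1, p.2 + 1)) (i : I) (a : ZMod r) :
    G (i, a) = ((G (i, 0)).1, (G (i, 0)).2 + a) := by
  have step : ∀ b, G (i, b + 1) = ((G (i, b)).1, (G (i, b)).2 + 1) := fun b => by
    rw [← hG, hG (i, b)]
  obtain ⟨k, rfl⟩ := ZMod.intCast_surjective a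
  induction k with
  | zero => simp
  | succ n ih => push_cast at ih ⊢; rw [step, ih]; simp [add_assoc]
  | pred n ih =>
    push_cast at ih ⊢
    have := step (-(n : ZMod r) - 1)
    rw [sub_add_cancel, ih] at this
    apply Prod.ext
    · exact (congrArg Prod.fst this).symm
    · have h2 := congrArg Prod.snd this
      simp only at h2 ⊢
      linear_combination -h2

/-- Square roots of the unit translation are determined by their values on `I × {0}`. -/
def shiftSqrtEquiv {I : Type*} (r : ℕ) :
    {G : I × ZMod r → I × ZMod r // ∀ p, G (G p) = (p.1, p.2 + 1)} ≃ ShiftSqrt r I where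
  toFun G := ⟨fun i => G.1 (i, 0), fun i => by
    have h1 := G.2 (i, 0)
    rw [sqrt_shift_apply G.1 G.2 (G.1 (i, 0)).1 (G.1 (i, 0)).2] at h1
    obtain ⟨h1, h2⟩ := Prod.ext_iff.mp h1
    refine Prod.ext h1 ?_
    simp only at h2 ⊢
    linear_combination h2⟩
  invFun h := ⟨fun p => ((h.1 p.1).1, (h.1 p.1).2 + p.2), fun p => by
    simp only [h.2 p.1]
    apply Prod.ext
    · rfl
    · simp only; ring⟩
  left_inv G := by
    ext1
    funext ⟨i, a⟩
    exact (sqrt_shift_apply G.1 G.2 i a).symm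
  right_inv h := by
    ext1
    funext i
    simp

/-- Square roots of the unit translation with a prescribed value at `i₀` correspond to
square roots on the remaining indices. -/
def shiftSqrtRestrictEquiv {I : Type*} [DecidableEq I] {r : ℕ} (i₀ j : I) (c : ZMod r)
    (hc : j = i₀ → c + c = 1) :
    {h : ShiftSqrt r I // h.1 i₀ = (j, c)} ≃ ShiftSqrt r {i // i ≠ i₀ ∧ i ≠ j} where
  toFun h := ⟨fun i => (⟨(h.1.1 i).1, by
      have h0 := h.1.2 i₀
      rw [h.2] at h0
      have hi := h.1.2 i
      constructor
      · intro e
        rw [e, h.2] at hi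
        exact i.2.2 (congrArg Prod.fst hi).symm
      · intro e
        rw [e, h0] at hi
        exact i.2.1 (congrArg Prod.fst hi).symm⟩, (h.1.1 i).2), fun i => by
    have hi := h.1.2 i
    obtain ⟨h1, h2⟩ := Prod.ext_iff.mp hi
    exact Prod.ext (Subtype.ext h1) h2⟩
  invFun g := ⟨⟨fun i => if hi : i ≠ i₀ ∧ i ≠ j then ((g.1 ⟨i, hi⟩).1, (g.1 ⟨i, hi⟩).2) else
      if i = i₀ then (j, c) else (i₀, 1 - c), fun i => by
    by_cases hi : i ≠ i₀ ∧ i ≠ j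
    · simp [hi, (g.1 ⟨i, hi⟩).1.2, g.2 ⟨i, hi⟩]
    · by_cases h0 : i = i₀
      · subst h0
        by_cases hj : j = i
        · subst hj
          simp [← hc rfl]
        · simp [hj]
      · obtain rfl : i = j := by tauto
        simp [h0]⟩, by simp⟩
  left_inv h := by
    have h0 := h.1.2 i₀
    rw [h.2] at h0
    ext1
    ext1
    funext i
    by_cases hi : i ≠ i₀ ∧ i ≠ j
    · simp [hi]
    · by_cases hi0 : i = i₀
      · subst hi0
        simp [h.2]
      · obtain rfl : i = j := by tauto
        simp [hi0, h0]
  right_inv g := by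
    ext1
    funext i
    simp [i.2]

/-- The number of square roots of a permutation made of `m` cycles of length `r`. -/
def sqrtCount (r m : ℕ) : ℕ :=
  if Odd r then oFun r m
  else if Even m then Nat.doubleFactorial (m - 1) * r ^ (m / 2) else 0

theorem choose_mul_doubleFactorial (m k : ℕ) :
    (m + 1).choose (2 * k + 1) * Nat.doubleFactorial (2 * k + 1) =
      (m + 1) * (m.choose (2 * k) * Nat.doubleFactorial (2 * k - 1)) := by
  rw [Nat.doubleFactorial_add_one, ← mul_assoc, ← Nat.add_one_mul_choose_eq]
  ring

theorem oFun_eq_sum_range {r m N : ℕ} (h : m / 2 + 1 ≤ N) :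
    oFun r m = ∑ k ∈ Finset.range N,
      m.choose (2 * k) * Nat.doubleFactorial (2 * k - 1) * r ^ k := by
  refine Finset.sum_subset (Finset.range_subset_range.mpr h) fun k _ hk => ?_
  rw [Nat.choose_eq_zero_of_lt (by simp at hk; omega)]
  simp

theorem oFun_add_two (r m : ℕ) :
    oFun r (m + 2) = oFun r (m + 1) + (m + 1) * r * oFun r m := by
  rw [oFun_eq_sum_range (N := m + 2 + 1) (by omega), oFun_eq_sum_range (m := m + 1) (N := m + 2 + 1)
    (by omega), oFun_eq_sum_range (m := m) (N := m + 2) (by omega), Finset.sum_range_succ',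
    Finset.sum_range_succ' _ (m + 2), Finset.mul_sum, add_right_comm, ← Finset.sum_add_distrib]
  congr 1
  refine Finset.sum_congr rfl fun k _ => ?_
  have h := choose_mul_doubleFactorial m k
  rw [show 2 * (k + 1) = 2 * k + 1 + 1 by ring, Nat.choose_succ_succ (m + 1), Nat.add_sub_cancel]
  linear_combination (r ^ (k + 1)) * h

theorem sqrtCount_zero (r : ℕ) : sqrtCount r 0 = 1 := by
  simp [sqrtCount, oFun]

theorem sqrtCount_one (r : ℕ) : sqrtCount r 1 = if Odd r then 1 else 0 := by
  simp [sqrtCount, oFun]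

theorem sqrtCount_add_two (r m : ℕ) :
    sqrtCount r (m + 2) =
      (if Odd r then 1 else 0) * sqrtCount r (m + 1) + (m + 1) * r * sqrtCount r m := by
  unfold sqrtCount
  split_ifs with h1 h2 h3 h3 h3 h3
  · simp [oFun_add_two]
  all_goals first | (exfalso; grind) | skip
  · obtain ⟨k, rfl⟩ := h3
    rw [show k + k + 2 - 1 = k + k + 1 by omega, Nat.doubleFactorial_add_one,
      show (k + k + 2) / 2 = (k + k) / 2 + 1 by omega]
    ring
  · simp

theorem card_zmod_add_self_eq_one (r : ℕ) [NeZero r] :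
    Nat.card {c : ZMod r // c + c = 1} = if Odd r then 1 else 0 := by
  split_ifs with h
  · obtain ⟨k, rfl⟩ := h
    have hk : (2 : ZMod (2 * k + 1)) * k + 1 = 0 := by
      exact_mod_cast ZMod.natCast_self (2 * k + 1)
    rw [Nat.card_eq_one_iff_unique]
    refine ⟨⟨fun a b => Subtype.ext ?_⟩, ⟨⟨k + 1, by linear_combination hk⟩⟩⟩
    linear_combination (-(k : ZMod (2 * k + 1))) * a.2 + (k : ZMod (2 * k + 1)) * b.2
      + (a.1 - b.1) * hk
  · rw [Nat.card_eq_zero]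
    left
    refine ⟨fun c => ?_⟩
    have h2 : 2 ∣ r := (Nat.not_odd_iff_even.mp h).two_dvd
    have := congrArg (ZMod.castHom h2 (ZMod 2)) c.2
    rw [map_add, map_one] at this
    generalize ZMod.castHom h2 (ZMod 2) c.1 = x at this
    revert x
    decide

theorem card_shiftSqrt_fiber {I : Type*} [Finite I] {r : ℕ} (i₀ j : I) (c : ZMod r)
    (hc : j = i₀ → c + c = 1) :
    Nat.card {h : ShiftSqrt r I // h.1 i₀ = (j, c)} =
      Nat.card (ShiftSqrt r {i // i ≠ i₀ ∧ i ≠ j}) := by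
  classical
  exact Nat.card_congr (shiftSqrtRestrictEquiv i₀ j c hc)

/-- Square roots of the unit translation of `I × ZMod r` are counted by `sqrtCount`. -/
theorem card_shiftSqrt (r : ℕ) [NeZero r] (m : ℕ) :
    ∀ (I : Type*) [Finite I], Nat.card I = m → Nat.card (ShiftSqrt r I) = sqrtCount r m := by
  classical
  induction m using Nat.strong_induction_on with
  | _ m ih =>
  intro I _ hI
  have := Fintype.ofFinite I
  rw [Nat.card_eq_fintype_card] at hI
  rcases m with _ | m
  · have := Fintype.card_eq_zero_iff.mp hI
    rw [sqrtCount_zero, Nat.card_eq_one_iff_unique]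
    exact ⟨inferInstance, ⟨⟨isEmptyElim, isEmptyElim⟩⟩⟩
  obtain ⟨i₀⟩ : Nonempty I := Fintype.card_pos_iff.mp (by omega)
  have hself : ∀ c : ZMod r, Nat.card {h : ShiftSqrt r I // h.1 i₀ = (i₀, c)} =
      if c + c = 1 then sqrtCount r m else 0 := by
    intro c
    split_ifs with hc
    · rw [card_shiftSqrt_fiber i₀ i₀ c fun _ => hc]
      refine ih m (by omega) _ ?_
      simp only [and_self, Nat.card_eq_fintype_card]
      rw [Fintype.card_subtype_compl, Fintype.card_subtype_eq]
      omega
    · rw [Nat.card_eq_zero]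
      left
      refine ⟨fun h => hc ?_⟩
      have h0 := h.1.2 i₀
      rw [h.2, h.2] at h0
      have h1 := congrArg Prod.snd h0
      simp only at h1
      linear_combination h1
  have hother : ∀ j ∈ Finset.univ.erase i₀, ∀ c : ZMod r,
      Nat.card {h : ShiftSqrt r I // h.1 i₀ = (j, c)} = sqrtCount r (m - 1) := by
    intro j hj c
    have hj : j ≠ i₀ := by simpa using hj
    rw [card_shiftSqrt_fiber i₀ j c fun h => absurd h hj]
    refine ih (m - 1) (by omega) _ ?_
    have h2 : Fintype.card {i // i ≠ i₀ ∧ i ≠ j} = Fintype.card I - 2 := by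
      rw [Fintype.card_subtype, ← Finset.card_pair hj.symm, ← Finset.card_compl]
      congr 1
      ext
      simp
    rw [Nat.card_eq_fintype_card, h2]
    omega
  rw [← Nat.card_congr (Equiv.sigmaFiberEquiv fun h : ShiftSqrt r I => h.1 i₀), Nat.card_sigma,
    Fintype.sum_prod_type, ← Finset.add_sum_erase _ _ (Finset.mem_univ i₀),
    Finset.sum_congr rfl fun c _ => hself c,
    Finset.sum_congr rfl fun j hj => Finset.sum_congr rfl fun c _ => hother j hj c,
    ← Finset.sum_filter, Finset.sum_const, ← Fintype.card_subtype, ← Nat.card_eq_fintype_card,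
    card_zmod_add_self_eq_one]
  simp only [Finset.sum_const, Finset.card_univ, ZMod.card, smul_eq_mul,
    Finset.card_erase_of_mem (Finset.mem_univ _), hI]
  rcases m with _ | m
  · simp [sqrtCount_zero, sqrtCount_one]
  · rw [sqrtCount_add_two]
    simp [mul_assoc]

/-- Square roots of a permutation all of whose orbits have size `r`. -/
theorem card_sqrt_of_minimalPeriod_eq {P : Type*} [Finite P] (u : Equiv.Perm P) (r m : ℕ)
    (hr : 0 < r) (h : ∀ p, Function.minimalPeriod u p = r) (hm : Nat.card P = r * m) :
    Nat.card {g : P → P // ∀ p, g (g p) = u p} = sqrtCount r m := by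
  have : NeZero r := ⟨hr.ne'⟩
  obtain ⟨I, _, e, he⟩ := exists_equiv_prod_zmod u r h
  have hI : Nat.card I = m := by
    rw [← Nat.card_congr e, Nat.card_prod, Nat.card_zmod, mul_comm] at hm
    exact Nat.eq_of_mul_eq_mul_left hr hm
  rw [← card_shiftSqrt r m I hI, ← Nat.card_congr (shiftSqrtEquiv r)]
  refine Nat.card_congr ((e.symm.arrowCongr e.symm).subtypeEquiv fun g => ?_)
  rw [← e.forall_congr_right]
  refine forall_congr' fun p => ?_
  simp [← he, Equiv.symm_apply_eq]

theorem minimalPeriod_eq_card_support_cycleOf {α : Type*} [Fintype α] [DecidableEq α]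
    (w : Equiv.Perm α) {a : α} (ha : w a ≠ a) :
    Function.minimalPeriod w a = (w.cycleOf a).support.card := by
  refine Nat.dvd_right_iff_eq.mp fun k => ?_
  rw [← Function.isPeriodicPt_iff_minimalPeriod_dvd,
    ← (w.isCycleOn_support_cycleOf a).pow_apply_eq
      (Equiv.Perm.mem_support_cycleOf_iff.mpr ⟨.refl _ _, by simpa using ha⟩),
    Function.IsPeriodicPt, Function.IsFixedPt, Equiv.Perm.iterate_eq_pow]

/-- The points on cycles of length `r`, counted through the cycle type. -/
theorem card_minimalPeriod_eq {α : Type*} [Fintype α] [DecidableEq α] (w : Equiv.Perm α)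
    {r : ℕ} (hr : 0 < r) :
    (Finset.univ.filter fun a => Function.minimalPeriod w a = r).card =
      r * w.partition.parts.count r := by
  rcases Nat.eq_or_lt_of_le hr with hr1 | hr1
  · obtain rfl : 1 = r := hr1
    have h1 : w.cycleType.count 1 = 0 :=
      Multiset.count_eq_zero.mpr fun h => (Equiv.Perm.one_lt_of_mem_cycleType h).ne rfl
    rw [Equiv.Perm.parts_partition, Multiset.count_add, h1, Multiset.count_replicate_self, zero_add,
      one_mul, ← Finset.card_compl]
    congr 1
    ext a
    simp [Function.minimalPeriod_eq_one_iff_isFixedPt, Function.IsFixedPt]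
  have hne : ∀ a, Function.minimalPeriod w a = r → w a ≠ a := fun a ha h => by
    rw [Function.minimalPeriod_eq_one_iff_isFixedPt.mpr h] at ha
    omega
  rw [Equiv.Perm.parts_partition, Multiset.count_add, Multiset.count_replicate, if_neg (by omega),
    add_zero, Equiv.Perm.cycleType_def, Multiset.count_map, mul_comm]
  change _ = (w.cycleFactorsFinset.filter fun c => r = c.support.card).card * r
  rw [Finset.card_eq_sum_card_fiberwise (f := w.cycleOf)
    (t := w.cycleFactorsFinset.filter fun c => r = c.support.card)]
  · refine Finset.sum_const_nat fun c hcr => ?_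
    obtain ⟨hc, rfl⟩ := Finset.mem_filter.mp hcr
    congr 1
    ext a
    rw [Finset.mem_filter, Finset.mem_filter]
    constructor
    · rintro ⟨⟨-, ha⟩, rfl⟩
      exact Equiv.Perm.mem_support_cycleOf_iff.mpr ⟨.refl _ _, by simpa using hne a ha⟩
    · intro ha
      have hca := Equiv.Perm.cycle_is_cycleOf ha hc
      have hwa := Equiv.Perm.mem_support.mp
        (Equiv.Perm.mem_cycleFactorsFinset_support_le hc ha)
      exact ⟨⟨Finset.mem_univ _, by rw [minimalPeriod_eq_card_support_cycleOf w hwa, ← hca]⟩,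
        hca.symm⟩
  · intro a ha
    have ha : Function.minimalPeriod w a = r := by simpa using ha
    have hwa := hne a ha
    simp only [Finset.coe_filter, Set.mem_ofPred_eq]
    rw [Equiv.Perm.cycleOf_mem_cycleFactorsFinset_iff, Equiv.Perm.mem_support,
      ← minimalPeriod_eq_card_support_cycleOf w hwa]
    exact ⟨hwa, ha.symm⟩

/-- The number of square roots of the restriction of a permutation to its cycles of length `r`. -/
theorem card_sqrt_fiber {α : Type*} [Fintype α] [DecidableEq α] (w : Equiv.Perm α) (r : ℕ)
    (q : α → Prop) (hq : ∀ a, q a ↔ Function.minimalPeriod w a = r) :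
    Nat.card {y : {a // q a} → {a // q a} // ∀ p, (y (y p) : α) = w p} =
      sqrtCount r (w.partition.parts.count r) := by
  obtain rfl : q = fun a => Function.minimalPeriod w a = r := funext fun a => propext (hq a)
  have hpos : ∀ a, 0 < Function.minimalPeriod w a := fun a =>
    Function.minimalPeriod_pos_of_mem_periodicPts (w.injective.mem_periodicPts a)
  rcases Nat.eq_zero_or_pos r with rfl | hr
  · have : IsEmpty {a // Function.minimalPeriod w a = 0} := ⟨fun a => (hpos a).ne' a.2⟩
    rw [Multiset.count_eq_zero.mpr fun h => (w.partition.parts_pos h).ne rfl, sqrtCount_zero,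
      Nat.card_eq_one_iff_unique]
    exact ⟨inferInstance, ⟨⟨isEmptyElim, isEmptyElim⟩⟩⟩
  have hw : ∀ a, Function.minimalPeriod w (w a) = r ↔ Function.minimalPeriod w a = r := fun a => by
    rw [Function.minimalPeriod_apply (w.injective.mem_periodicPts a)]
  have hu : ∀ p, Function.minimalPeriod
      (w.subtypePerm (p := fun a => Function.minimalPeriod w a = r) hw) p = r := fun p => by
    refine Eq.trans ?_ p.2
    rw [Function.minimalPeriod_eq_minimalPeriod_iff]
    intro k
    simp only [Function.IsPeriodicPt, Function.IsFixedPt, Equiv.Perm.iterate_eq_pow,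
      Equiv.Perm.subtypePerm_pow, Subtype.ext_iff, Equiv.Perm.subtypePerm_apply]
  rw [← card_sqrt_of_minimalPeriod_eq (w.subtypePerm hw) r _ hr hu]
  · simp [Subtype.ext_iff]
  · rw [Nat.card_eq_fintype_card, Fintype.card_subtype, card_minimalPeriod_eq w hr]

theorem prod_even_mul_prod_odd (f : ℕ → ℕ) (n : ℕ) :
    (∏ i ∈ Finset.Icc 1 n, f (2 * i)) * ∏ j ∈ Finset.range n, f (2 * j + 1) =
      ∏ r ∈ Finset.range (2 * n), f (r + 1) := by
  induction n with
  | zero => simp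
  | succ n ih =>
    rw [Finset.prod_Icc_succ_top (by omega), Finset.prod_range_succ, mul_mul_mul_comm, ih,
      show 2 * (n + 1) = 2 * n + 1 + 1 by ring, Finset.prod_range_succ, Finset.prod_range_succ]
    ring

/-- The number of square roots in `S_n` of a permutation `w` of cycle type `λ`,
where every even part of `λ` has even multiplicity, is
`∏_i (m_{2i}-1)!! (2i)^{m_{2i}/2} · ∏_j o_{2j+1}(m_{2j+1})`. -/
theorem card_sqrt_eq (n : ℕ) (lam : n.Partition)
    (heven : ∀ i : ℕ, Even (lam.parts.count (2 * i)))
    (w : Equiv.Perm (Fin n)) (hw : w.partition.parts = lam.parts) :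
    Nat.card {x : Equiv.Perm (Fin n) // x ^ 2 = w} =
      (∏ i ∈ Finset.Icc 1 n,
        Nat.doubleFactorial (lam.parts.count (2 * i) - 1) *
          (2 * i) ^ (lam.parts.count (2 * i) / 2)) *
      ∏ j ∈ Finset.range n, oFun (2 * j + 1) (lam.parts.count (2 * j + 1)) := by
  have hf : ∀ a, Function.minimalPeriod w a < 2 * n + 1 := fun a => by
    have := Function.minimalPeriod_le_card (f := w) (x := a)
    rw [Fintype.card_fin] at this
    omega
  have h0 : lam.parts.count 0 = 0 :=
    Multiset.count_eq_zero.mpr fun h => (lam.parts_pos h).ne rfl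
  let f : Fin n → Fin (2 * n + 1) := fun a => ⟨Function.minimalPeriod w a, hf a⟩
  rw [Nat.card_congr (sqrtPermEquiv w), Nat.card_congr (sqrtFiberEquiv w f
    fun g hg a => Fin.ext (minimalPeriod_eq_of_sqrt w g hg a)), Nat.card_pi]
  refine (Finset.prod_congr rfl fun (r : Fin (2 * n + 1)) _ =>
    card_sqrt_fiber w r (fun a => f a = r) fun a => Fin.ext_iff).trans ?_
  rw [hw, Fin.prod_univ_eq_prod_range (fun r => sqrtCount r (lam.parts.count r)),
    Finset.prod_range_succ', h0, sqrtCount_zero, mul_one,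
    ← prod_even_mul_prod_odd fun r => sqrtCount r (lam.parts.count r)]
  congr 1
  · exact Finset.prod_congr rfl fun i _ => by simp [sqrtCount, heven i]
  · exact Finset.prod_congr rfl fun j _ => by simp [sqrtCount]
end

section
/- For all n ≥ 4, the sum s_n of all entries of the character table of S_n satisfies s_n ≤ i_n + i_{n−1}, where i_n is the number of involutions in S_n. Consequently s_n ≤ 2·i_n, i.e., the character table sum of S_n is at most twice the character degree sum. -/
open CategoryTheory
open scoped ComplexOrder

/-- `S` is the (finite) set of irreducible complex characters of `G`. -/
def IsIrrFamily (G : Type) [Group G] (S : Finset (G → ℂ)) : Prop :=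
  (∀ f ∈ S, ∃ V : FDRep ℂ G, Simple V ∧ V.character = f) ∧
  ∀ V : FDRep ℂ G, Simple V → V.character ∈ S

/-- The character table sum. -/
noncomputable def tableSum (G : Type) [Group G] (S : Finset (G → ℂ)) : ℂ :=
  ∑ f ∈ S, ∑ᶠ C : ConjClasses G, f (Quotient.out C)

/-- The number of involutions in `S_k`, which equals the character degree sum of `S_k`. -/
noncomputable def numInvolutions (k : ℕ) : ℕ :=
  Nat.card {x : Equiv.Perm (Fin k) // x ^ 2 = 1}

namespace Representation

section Irreducible

variable {G V : Type*} [Group G] [AddCommGroup V] [Module ℂ V] {ρ : Representation ℂ G V}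

theorem isIrreducible_of_forall [Nontrivial V]
    (h : ∀ U : Submodule ℂ V, (∀ g, ∀ v ∈ U, ρ g v ∈ U) → (∃ v ∈ U, v ≠ 0) → U = ⊤) :
    ρ.IsIrreducible where
  exists_pair_ne := by
    obtain ⟨v, hv⟩ := exists_ne (0 : V)
    refine ⟨⊥, ⊤, fun e => hv ?_⟩
    have : v ∈ (⊤ : Subrepresentation ρ).toSubmodule := Submodule.mem_top
    rw [← e] at this
    exact (Submodule.mem_bot ℂ).1 this
  eq_bot_or_eq_top U := by
    by_cases hU : ∃ v ∈ U.toSubmodule, v ≠ 0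
    · exact Or.inr (Subrepresentation.toSubmodule_injective
        (h U.toSubmodule (fun g v hv => U.apply_mem_toSubmodule g hv) hU))
    · push Not at hU
      exact Or.inl (Subrepresentation.toSubmodule_injective ((Submodule.eq_bot_iff _).2 hU))

theorem IsIrreducible.nontrivial (h : ρ.IsIrreducible) : Nontrivial V := by
  by_contra hV
  rw [not_nontrivial_iff_subsingleton] at hV
  obtain ⟨U, W, hUW⟩ := exists_pair_ne (Subrepresentation ρ)
  exact hUW (Subrepresentation.toSubmodule_injective (Subsingleton.elim _ _))

theorem IsIrreducible.eq_top_of_invariant (h : ρ.IsIrreducible) (U : Submodule ℂ V)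
    (hU : ∀ g, ∀ v ∈ U, ρ g v ∈ U) {v : V} (hv : v ∈ U) (hv0 : v ≠ 0) : U = ⊤ := by
  rcases h.eq_bot_or_eq_top ⟨U, fun g v hv => hU g v hv⟩ with e | e
  · have : U = ⊥ := congrArg Subrepresentation.toSubmodule e
    rw [this] at hv
    exact absurd ((Submodule.mem_bot ℂ).1 hv) hv0
  · exact congrArg Subrepresentation.toSubmodule e

theorem IsIrreducible.exists_eq_smul [FiniteDimensional ℂ V] (h : ρ.IsIrreducible)
    (T : V →ₗ[ℂ] V) (hT : ∀ g v, T (ρ g v) = ρ g (T v)) : ∃ c : ℂ, ∀ v, T v = c • v := by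
  have := h.nontrivial
  obtain ⟨c, hc⟩ := Module.End.exists_eigenvalue T
  obtain ⟨v, hv⟩ := hc.exists_hasEigenvector
  refine ⟨c, fun w => Module.End.mem_eigenspace_iff.1 ?_⟩
  rw [h.eq_top_of_invariant (Module.End.eigenspace T c) (fun g u hu => ?_) hv.1 hv.2]
  · trivial
  · rw [Module.End.mem_eigenspace_iff] at hu ⊢
    rw [hT, hu, map_smul]

theorem exists_irreducible_subrepresentation_le [FiniteDimensional ℂ V]
    (C : Subrepresentation ρ) (hC : ∃ v ∈ C.toSubmodule, v ≠ 0) :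
    ∃ U : Subrepresentation ρ, U.toSubmodule ≤ C.toSubmodule ∧
      U.toRepresentation.IsIrreducible := by
  classical
  have hex : ∃ d, ∃ U : Subrepresentation ρ, U.toSubmodule ≤ C.toSubmodule ∧
      (∃ v ∈ U.toSubmodule, v ≠ 0) ∧ Module.finrank ℂ U.toSubmodule = d :=
    ⟨_, C, le_rfl, hC, rfl⟩
  obtain ⟨U, hUC, ⟨v, hvU, hv⟩, hd⟩ := Nat.find_spec hex
  have : Nontrivial U.toSubmodule := ⟨⟨v, hvU⟩, 0, fun e => hv (congrArg Subtype.val e)⟩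
  refine ⟨U, hUC, isIrreducible_of_forall fun W hW hW0 => ?_⟩
  obtain ⟨w, hwW, hw⟩ := hW0
  have hle := Nat.find_min' hex ⟨⟨W.map U.toSubmodule.subtype, fun g x hx => ?_⟩,
    (Submodule.map_subtype_le _ _).trans hUC,
    ⟨w, Submodule.mem_map_of_mem hwW, fun e => hw (Subtype.ext e)⟩, rfl⟩
  · rw [← hd, Submodule.finrank_map_subtype_eq] at hle
    exact Submodule.eq_top_of_finrank_eq (le_antisymm (Submodule.finrank_le W) hle)
  · obtain ⟨y, hy, rfl⟩ := Submodule.mem_map.1 hx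
    exact Submodule.mem_map.2 ⟨_, hW g y hy, rfl⟩

end Irreducible

section Finite

variable {G V : Type*} [Group G] [Fintype G] [AddCommGroup V] [Module ℂ V]

theorem sum_conj_commute (ρ : Representation ℂ G V) (p : V →ₗ[ℂ] V) (g : G) (v : V) :
    (∑ h, ρ h ∘ₗ p ∘ₗ ρ h⁻¹) (ρ g v) = ρ g ((∑ h, ρ h ∘ₗ p ∘ₗ ρ h⁻¹) v) := by
  simp only [LinearMap.sum_apply, LinearMap.comp_apply, map_sum]
  refine Fintype.sum_equiv (Equiv.mulLeft g⁻¹) _ _ fun h => ?_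
  simp only [Equiv.coe_mulLeft, ← Module.End.mul_apply, ← map_mul]
  simp [mul_assoc]

theorem exists_equivariant_projection (ρ : Representation ℂ G V) (U : Submodule ℂ V)
    (hU : ∀ g, ∀ v ∈ U, ρ g v ∈ U) :
    ∃ P : V →ₗ[ℂ] V, (∀ g v, P (ρ g v) = ρ g (P v)) ∧ (∀ v, P v ∈ U) ∧ ∀ u ∈ U, P u = u := by
  obtain ⟨q, hq⟩ := U.subtype.exists_leftInverse_of_injective U.ker_subtype
  have hqU : ∀ u (hu : u ∈ U), (q u : V) = u := fun u hu =>
    congrArg Subtype.val (LinearMap.congr_fun hq ⟨u, hu⟩)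
  refine ⟨(Fintype.card G : ℂ)⁻¹ • ∑ h, ρ h ∘ₗ (U.subtype ∘ₗ q) ∘ₗ ρ h⁻¹, fun g v => ?_,
    fun v => ?_, fun u hu => ?_⟩
  · rw [LinearMap.smul_apply, sum_conj_commute, LinearMap.smul_apply, map_smul]
  · rw [LinearMap.smul_apply, LinearMap.sum_apply]
    exact U.smul_mem _ (U.sum_mem fun h _ => hU _ _ (Subtype.mem _))
  · have : ∀ h ∈ Finset.univ, (ρ h ∘ₗ (U.subtype ∘ₗ q) ∘ₗ ρ h⁻¹) u = u := fun h _ => by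
      simp only [LinearMap.comp_apply, Submodule.subtype_apply]
      rw [hqU _ (hU _ _ hu), self_inv_apply]
    rw [LinearMap.smul_apply, LinearMap.sum_apply, Finset.sum_congr rfl this]
    simp [← Nat.cast_smul_eq_nsmul ℂ, smul_smul]

variable {ρ : Representation ℂ G V} [FiniteDimensional ℂ V]

/-- Fourier inversion on a single irreducible representation. -/
theorem IsIrreducible.sum_trace_smul (hρ : ρ.IsIrreducible) (A : V →ₗ[ℂ] V) (w : V) :
    (Module.finrank ℂ V : ℂ) • ∑ g, LinearMap.trace ℂ V (ρ g⁻¹ ∘ₗ A) • ρ g w =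
      (Fintype.card G : ℂ) • A w := by
  have key : ∀ (f : V →ₗ[ℂ] ℂ) (u : V),
      (Module.finrank ℂ V : ℂ) • ∑ g, f (ρ g⁻¹ u) • ρ g w =
        ((Fintype.card G : ℂ) * f w) • u := fun f u => by
    obtain ⟨c, hc⟩ := hρ.exists_eq_smul _ (sum_conj_commute ρ (f.smulRight w))
    have htr : (Fintype.card G : ℂ) * f w = c * Module.finrank ℂ V := by
      have h1 : LinearMap.trace ℂ V (∑ h, ρ h ∘ₗ f.smulRight w ∘ₗ ρ h⁻¹) =
          (Fintype.card G : ℂ) * f w := by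
        rw [map_sum]
        have : ∀ h ∈ Finset.univ, LinearMap.trace ℂ V (ρ h ∘ₗ f.smulRight w ∘ₗ ρ h⁻¹) = f w := by
          intro h _
          rw [LinearMap.trace_comp_comm', LinearMap.comp_assoc]
          have : ρ h⁻¹ ∘ₗ ρ h = LinearMap.id := by ext; simp
          rw [this, LinearMap.comp_id, LinearMap.trace_smulRight]
        rw [Finset.sum_congr rfl this]
        simp
      have h2 : (∑ h, ρ h ∘ₗ f.smulRight w ∘ₗ ρ h⁻¹) = c • LinearMap.id := by
        ext v; exact hc v
      rw [← h1, h2]; simp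
    have := hc u
    simp only [LinearMap.sum_apply, LinearMap.comp_apply, LinearMap.smulRight_apply,
      map_smul] at this
    rw [this, htr, smul_smul, mul_comm]
  let b := Module.finBasis ℂ V
  have htr : ∀ g, LinearMap.trace ℂ V (ρ g⁻¹ ∘ₗ A) = ∑ i, b.coord i (ρ g⁻¹ (A (b i))) := fun g => by
    rw [LinearMap.trace_eq_matrix_trace ℂ b]
    simp [Matrix.trace, LinearMap.toMatrix_apply]
  simp_rw [htr, Finset.sum_smul]
  rw [Finset.sum_comm, Finset.smul_sum]
  simp_rw [key, mul_smul]
  rw [← Finset.smul_sum]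
  congr 1
  conv_rhs => rw [← b.sum_repr w, map_sum]
  simp

end Finite

/-- Every invariant bilinear form on an irreducible complex representation of `G` is symmetric. -/
def InvariantFormsSymm (G : Type) [Group G] : Prop :=
  ∀ (V : Type) [AddCommGroup V] [Module ℂ V] [FiniteDimensional ℂ V] (ρ : Representation ℂ G V),
    ρ.IsIrreducible → ∀ B : V →ₗ[ℂ] V →ₗ[ℂ] ℂ,
    (∀ g u v, B (ρ g u) (ρ g v) = B u v) → ∀ u v, B u v = B v u

theorem invariantFormsSymm_of_subsingleton (G : Type) [Group G] [Subsingleton G] :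
    InvariantFormsSymm G := by
  intro V _ _ _ ρ hρ B _ u v
  by_cases hu : u = 0
  · simp [hu]
  have hspan := hρ.eq_top_of_invariant (ℂ ∙ u)
    (fun g w hw => by rw [Subsingleton.elim g 1]; simpa using hw)
    (Submodule.mem_span_singleton_self u) hu
  obtain ⟨c, rfl⟩ := Submodule.mem_span_singleton.1 (hspan ▸ Submodule.mem_top (x := v))
  simp

section Gelfand

variable {G V : Type*} [Group G] [Fintype G] [AddCommGroup V] [Module ℂ V] [FiniteDimensional ℂ V]
  {ρ : Representation ℂ G V}

/-- Gelfand's trick: if every element of `G` is inverted by some element of `H`, the commutant of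
`H` consists of self-adjoint operators for any invariant form. -/
theorem IsIrreducible.selfAdjoint_of_commute (hρ : ρ.IsIrreducible) {H : Set G}
    (hH : ∀ g : G, ∃ k ∈ H, k * g * k⁻¹ = g⁻¹) (B : V →ₗ[ℂ] V →ₗ[ℂ] ℂ)
    (hB : ∀ g u v, B (ρ g u) (ρ g v) = B u v) (A : V →ₗ[ℂ] V)
    (hA : ∀ h ∈ H, ∀ v, A (ρ h v) = ρ h (A v)) (u v : V) : B (A u) v = B u (A v) := by
  have htr : ∀ g, LinearMap.trace ℂ V (ρ g ∘ₗ A) = LinearMap.trace ℂ V (ρ g⁻¹ ∘ₗ A) := by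
    intro g
    obtain ⟨k, hk, hkg⟩ := hH g
    have h1 : ρ g⁻¹ ∘ₗ A = ρ k ∘ₗ (ρ g ∘ₗ A) ∘ₗ ρ k⁻¹ := by
      ext w
      have hw : ρ k (ρ k⁻¹ w) = w := self_inv_apply ρ k w
      simp only [LinearMap.comp_apply]
      conv_lhs => rw [← hw, hA k hk, ← hkg]
      simp
    rw [h1, LinearMap.trace_comp_comm' _ (ρ k), LinearMap.comp_assoc, LinearMap.comp_assoc]
    have : ρ k⁻¹ ∘ₗ ρ k = LinearMap.id := by ext; simp
    rw [this, LinearMap.comp_id]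
  have hadj : ∀ g, B (ρ g u) v = B u (ρ g⁻¹ v) := fun g => by
    rw [← hB g u (ρ g⁻¹ v), self_inv_apply]
  have hu := congrArg (fun x => B x v) (hρ.sum_trace_smul A u)
  have hv := congrArg (fun x => B u x) (hρ.sum_trace_smul A v)
  simp only [map_smul, map_sum, LinearMap.smul_apply, LinearMap.sum_apply, hadj] at hu hv
  have hsum : ∑ g, LinearMap.trace ℂ V (ρ g⁻¹ ∘ₗ A) • B u (ρ g⁻¹ v) =
      ∑ g, LinearMap.trace ℂ V (ρ g⁻¹ ∘ₗ A) • B u (ρ g v) := by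
    refine Fintype.sum_equiv (Equiv.inv G) _ _ fun g => ?_
    simp [htr g]
  rw [hsum, hv] at hu
  exact (mul_left_cancel₀ (Nat.cast_ne_zero.2 Fintype.card_ne_zero) hu).symm

end Gelfand

theorem InvariantFormsSymm.of_hom {H G : Type} [Group H] [Group G] [Finite H] [Finite G]
    (ι : H →* G) (hι : ∀ g : G, ∃ k : H, ι k * g * (ι k)⁻¹ = g⁻¹) (hH : InvariantFormsSymm H) :
    InvariantFormsSymm G := by
  intro V _ _ _ ρ hρ B hB u v
  have := Fintype.ofFinite G
  have := Fintype.ofFinite H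
  have := hρ.nontrivial
  let σ : Representation ℂ H V := ρ.comp ι
  obtain ⟨W, -, hW⟩ := exists_irreducible_subrepresentation_le (ρ := σ) ⊤ <| by
    obtain ⟨v, hv⟩ := exists_ne (0 : V)
    exact ⟨v, Submodule.mem_top, hv⟩
  obtain ⟨P, hPσ, hPW, hP⟩ := exists_equivariant_projection σ W.toSubmodule
    (fun g v hv => W.apply_mem_toSubmodule g hv)
  have hsymm : ∀ x ∈ W.toSubmodule, ∀ y ∈ W.toSubmodule, B x y = B y x := fun x hx y hy =>
    hH _ W.toRepresentation hW (B.domRestrict₁₂ W.toSubmodule W.toSubmodule)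
      (fun g x y => hB (ι g) x y) ⟨x, hx⟩ ⟨y, hy⟩
  have hadj : ∀ x y, B (P x) y = B x (P y) :=
    hρ.selfAdjoint_of_commute (H := Set.range ι)
      (fun g => by obtain ⟨k, hk⟩ := hι g; exact ⟨ι k, ⟨k, rfl⟩, hk⟩) B hB P
      (by rintro _ ⟨h, rfl⟩ x; exact hPσ h x)
  let K := LinearMap.ker (B - B.flip)
  have hK : ∀ x, x ∈ K ↔ ∀ y, B x y = B y x := fun x => by
    simp [K, LinearMap.ext_iff, sub_eq_zero]
  have := hW.nontrivial
  obtain ⟨⟨w, hw⟩, hw0⟩ := exists_ne (0 : W.toSubmodule)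
  have hwK : w ∈ K := (hK w).2 fun y => by
    have h1 := hadj w y
    have h2 := hadj y w
    rw [hP w hw] at h1 h2
    rw [h1, ← h2, hsymm w hw _ (hPW y)]
  have htop := hρ.eq_top_of_invariant K (fun g x hx => (hK _).2 fun y => by
    rw [← hB g⁻¹, ← hB g⁻¹ y, inv_self_apply]
    exact (hK x).1 hx _) hwK (fun e => hw0 (Subtype.ext e))
  exact (hK u).1 (htop ▸ Submodule.mem_top) v

theorem sum_character_sq {G V : Type} [Group G] [Fintype G] (hG : InvariantFormsSymm G)
    [AddCommGroup V] [Module ℂ V] [FiniteDimensional ℂ V] {ρ : Representation ℂ G V}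
    (hρ : ρ.IsIrreducible) : ∑ g, ρ.character (g ^ 2) = ∑ g, ρ.character g ^ 2 := by
  let b := Module.finBasis ℂ V
  let B : ∀ _ _, V →ₗ[ℂ] V →ₗ[ℂ] ℂ := fun k l =>
    ∑ g, (LinearMap.mul ℂ ℂ).compl₁₂ (b.coord k ∘ₗ ρ g) (b.coord l ∘ₗ ρ g)
  have hB : ∀ k l u v, B k l u v = ∑ g, b.repr (ρ g u) k * b.repr (ρ g v) l := fun k l u v => by
    simp [B, LinearMap.sum_apply]
  have hsymm : ∀ i j, B i j (b i) (b j) = B i j (b j) (b i) := fun i j =>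
    hG V ρ hρ (B i j) (fun g u v => by
      rw [hB, hB]
      refine Fintype.sum_equiv (Equiv.mulRight g) _ _ fun h => ?_
      simp) _ _
  have hch : ∀ g, ρ.character g = ∑ i, b.repr (ρ g (b i)) i := fun g => by
    rw [character, LinearMap.trace_eq_matrix_trace ℂ b]
    simp [Matrix.trace, LinearMap.toMatrix_apply]
  have hexp : ∀ g (w : V), ρ g w = ∑ j, b.repr w j • ρ g (b j) := fun g w => by
    conv_lhs => rw [← b.sum_repr w, map_sum]
    simp
  have h1 : ∑ g, ρ.character (g ^ 2) = ∑ i, ∑ j, B i j (b j) (b i) := by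
    simp_rw [hB]
    rw [Finset.sum_congr rfl fun i _ => Finset.sum_comm, Finset.sum_comm]
    refine Finset.sum_congr rfl fun g _ => ?_
    rw [hch]
    refine Finset.sum_congr rfl fun i _ => ?_
    rw [pow_two, map_mul, Module.End.mul_apply, hexp g (ρ g (b i))]
    simp [Finsupp.finsetSum_apply, mul_comm]
  have h2 : ∑ g, ρ.character g ^ 2 = ∑ i, ∑ j, B i j (b i) (b j) := by
    simp_rw [hB]
    rw [Finset.sum_congr rfl fun i _ => Finset.sum_comm, Finset.sum_comm]
    refine Finset.sum_congr rfl fun g _ => ?_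
    rw [hch, pow_two, Finset.sum_mul_sum]
  rw [h1, h2]
  exact Finset.sum_congr rfl fun i _ => Finset.sum_congr rfl fun j _ => (hsymm i j).symm

theorem sum_smul_commute {G V : Type*} [Group G] [Fintype G] [AddCommGroup V] [Module ℂ V]
    (ρ : Representation ℂ G V) {f : G → ℂ} (hf : ∀ g h, f (h * g * h⁻¹) = f g) (g : G) (v : V) :
    (∑ g, f g • ρ g) (ρ g v) = ρ g ((∑ g, f g • ρ g) v) := by
  simp only [LinearMap.sum_apply, LinearMap.smul_apply, map_sum, map_smul,
    ← Module.End.mul_apply, ← map_mul]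
  refine Fintype.sum_equiv (MulAut.conj g⁻¹).toEquiv _ _ fun k => ?_
  have := hf k g⁻¹
  simp only [MulEquiv.toEquiv_eq_coe, MulEquiv.coe_toEquiv, MulAut.conj_apply] at this ⊢
  rw [this]
  simp [mul_assoc]

/-- A class function orthogonal to all irreducible characters vanishes. -/
theorem eq_zero_of_forall_sum_mul_character {G : Type} [Group G] [Fintype G] (f : G → ℂ)
    (hf : ∀ g h, f (h * g * h⁻¹) = f g)
    (h : ∀ (V : Type) [AddCommGroup V] [Module ℂ V] [FiniteDimensional ℂ V]
      (ρ : Representation ℂ G V), ρ.IsIrreducible → ∑ g, f g * ρ.character g = 0) : f = 0 := by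
  have hzero : ∀ (V : Type) [AddCommGroup V] [Module ℂ V] [FiniteDimensional ℂ V]
      (ρ : Representation ℂ G V), ρ.IsIrreducible → ∑ g, f g • ρ g = 0 := by
    intro V _ _ _ ρ hρ
    obtain ⟨c, hc⟩ := hρ.exists_eq_smul (∑ g, f g • ρ g) (sum_smul_commute ρ hf)
    have hT : ∑ g, f g • ρ g = c • LinearMap.id := by ext v; exact hc v
    have htr := congrArg (LinearMap.trace ℂ V) hT
    simp only [map_sum, map_smul, LinearMap.trace_id, smul_eq_mul] at htr
    have h0 := h V ρ hρ
    simp only [character] at h0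
    have := hρ.nontrivial
    rw [h0, eq_comm, mul_eq_zero] at htr
    rw [hT, htr.resolve_right (Nat.cast_ne_zero.2 Module.finrank_pos.ne'), zero_smul]
  let ρ := leftRegular ℂ G
  let T := ∑ g, f g • ρ g
  have hTρ : ∀ g v, T (ρ g v) = ρ g (T v) := sum_smul_commute ρ hf
  have hT : T = 0 := by
    by_contra hT
    obtain ⟨P, hPρ, hPK, hP⟩ := exists_equivariant_projection ρ (LinearMap.ker T)
      fun g v hv => by
        rw [LinearMap.mem_ker] at hv ⊢
        rw [hTρ, hv, map_zero]
    obtain ⟨v, hv⟩ : ∃ v, T v ≠ 0 := by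
      by_contra! hv
      exact hT (LinearMap.ext hv)
    obtain ⟨W, hWP, hW⟩ := exists_irreducible_subrepresentation_le (ρ := ρ)
      ⟨LinearMap.ker P, fun g v hv => by
        rw [LinearMap.mem_ker] at hv ⊢
        rw [hPρ, hv, map_zero]⟩
      ⟨v - P v, by rw [LinearMap.mem_ker, map_sub, hP _ (hPK v), sub_self],
        fun e => hv (by rw [sub_eq_zero.1 e]; exact hPK v)⟩
    have := hW.nontrivial
    obtain ⟨w, hw⟩ := exists_ne (0 : W.toSubmodule)
    have hTw : T w = 0 := by
      have := congrArg Subtype.val (LinearMap.congr_fun (hzero _ W.toRepresentation hW) w)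
      simp only [LinearMap.sum_apply, LinearMap.smul_apply, AddSubmonoidClass.coe_finsetSum,
        Submodule.coe_smul, LinearMap.zero_apply, ZeroMemClass.coe_zero] at this
      simp only [T, LinearMap.sum_apply, LinearMap.smul_apply]
      exact this
    have hPw : P w = 0 := hWP w.2
    rw [hP _ hTw] at hPw
    exact hw (Subtype.ext hPw)
  funext g
  classical
  have := DFunLike.congr_fun (congrArg (MonoidAlgebra.coeffLinearEquiv ℂ)
    (LinearMap.congr_fun hT (MonoidAlgebra.single 1 1))) g
  simpa [T, ρ, LinearMap.sum_apply, Finsupp.finsetSum_apply, Finsupp.single_apply] using this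

theorem sum_character_mul_inv {G V : Type*} [Group G] [Fintype G] [AddCommGroup V] [Module ℂ V]
    [FiniteDimensional ℂ V] {ρ : Representation ℂ G V} (hρ : ρ.IsIrreducible) :
    ∑ g, ρ.character g * ρ.character g⁻¹ = Nat.card G := by
  have := invertibleOfNonzero (NeZero.ne (Nat.card G : ℂ))
  have h := char_orthonormal ρ ρ
  rw [if_pos ⟨Equiv.refl ρ⟩, inv_mul_eq_one₀ (NeZero.ne _)] at h
  exact h.symm

theorem IsIrreducible.simple_of {G V : Type} [Group G] [Fintype G] [AddCommGroup V] [Module ℂ V]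
    [FiniteDimensional ℂ V] {ρ : Representation ℂ G V} (hρ : ρ.IsIrreducible) :
    Simple (FDRep.of ρ) :=
  (FDRep.simple_iff_char_is_norm_one _).2 (sum_character_mul_inv hρ)

end Representation

/-- The number of square roots of `g`. -/
noncomputable def numSqrt {G : Type*} [Group G] (g : G) : ℕ :=
  Nat.card {x : G // x ^ 2 = g}

theorem numSqrt_conj {G : Type*} [Group G] (g h : G) : numSqrt (h * g * h⁻¹) = numSqrt g := by
  refine Nat.card_congr ((MulAut.conj h).toEquiv.subtypeEquiv fun x => ?_).symm
  have : (MulAut.conj h) x ^ 2 = h * x ^ 2 * h⁻¹ := by rw [← map_pow, MulAut.conj_apply]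
  simp only [MulEquiv.toEquiv_eq_coe, MulEquiv.coe_toEquiv, this, mul_left_inj, mul_right_inj]

theorem sum_numSqrt_mul {G : Type*} [Group G] [Fintype G] (ψ : G → ℂ) :
    ∑ g, (numSqrt g : ℂ) * ψ g = ∑ x, ψ (x ^ 2) := by
  classical
  rw [← Finset.sum_fiberwise Finset.univ (fun x : G => x ^ 2) (fun x => ψ (x ^ 2))]
  refine Finset.sum_congr rfl fun g _ => ?_
  rw [Finset.sum_congr rfl (g := fun _ => ψ g) fun x hx => by
    rw [(Finset.mem_filter.1 hx).2]]
  rw [Finset.sum_const, nsmul_eq_mul, numSqrt, Nat.card_eq_fintype_card, Fintype.card_subtype]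

/-- Frobenius-Schur for groups with real classes and symmetric invariant forms. -/
theorem IsIrrFamily.sum_apply {G : Type} [Group G] [Fintype G]
    (hG : Representation.InvariantFormsSymm G) (hinv : ∀ g : G, ∃ k, k * g * k⁻¹ = g⁻¹)
    {S : Finset (G → ℂ)} (hS : IsIrrFamily G S) (g : G) :
    ∑ f ∈ S, f g = numSqrt g := by
  have hconj : ∀ f ∈ S, ∀ g h, f (h * g * h⁻¹) = f g := fun f hf g h => by
    obtain ⟨V, -, rfl⟩ := hS.1 f hf
    exact V.char_conj g h
  have horth : ∀ ψ ∈ S, ∀ f ∈ S, ∑ g, f g * ψ g⁻¹ = if f = ψ then (Nat.card G : ℂ) else 0 := by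
    intro ψ hψ f hf
    have := invertibleOfNonzero (NeZero.ne (Nat.card G : ℂ))
    obtain ⟨V, hV, rfl⟩ := hS.1 ψ hψ
    obtain ⟨W, hW, rfl⟩ := hS.1 f hf
    split_ifs with h
    · rw [← h]
      exact (FDRep.simple_iff_char_is_norm_one W).1 hW
    · have := FDRep.char_orthonormal W V
      rw [if_neg fun ⟨i⟩ => h (FDRep.char_iso i)] at this
      exact (mul_eq_zero.1 this).resolve_left (inv_ne_zero (NeZero.ne _))
  have hzero := Representation.eq_zero_of_forall_sum_mul_character
    (fun g => ∑ f ∈ S, f g - (numSqrt g : ℂ)) (fun g h => by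
      rw [Finset.sum_congr rfl fun f hf => hconj f hf g h]
      rw [numSqrt_conj]) (by
      intro V _ _ _ ρ hρ
      have hψ : ρ.character ∈ S := hS.2 (FDRep.of ρ) hρ.simple_of
      have hreal : ∀ g, ρ.character g⁻¹ = ρ.character g := fun g => by
        obtain ⟨k, hk⟩ := hinv g
        rw [← hk, ρ.char_conj]
      simp only [sub_mul, Finset.sum_sub_distrib, Finset.sum_mul]
      rw [sum_numSqrt_mul, Representation.sum_character_sq hG hρ, Finset.sum_comm, sub_eq_zero]
      have h1 := Finset.sum_congr rfl (horth _ hψ)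
      simp only [hreal] at h1
      rw [h1, Finset.sum_ite_eq' S ρ.character, if_pos hψ,
        ← Representation.sum_character_mul_inv hρ]
      simp only [hreal, pow_two])
  exact sub_eq_zero.1 (congrFun hzero g)

namespace Equiv.Perm

/-- A permutation is inverted by a conjugation fixing any prescribed point. -/
theorem exists_conj_eq_inv_of_fixed {α : Type*} (g : Perm α) (p : α) :
    ∃ h : Perm α, h p = p ∧ h * g * h⁻¹ = g⁻¹ := by
  classical
  have hb : ∃ b : α → α, b p = p ∧ (∀ z, g.SameCycle (b z) z) ∧
      ∀ z w, g.SameCycle z w → b z = b w := by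
    let c : α → α := fun z => (Quotient.mk (SameCycle.setoid g) z).out
    have hc : ∀ z, g.SameCycle (c z) z := fun z =>
      Quotient.exact (s := SameCycle.setoid g) (Quotient.out_eq _)
    have hc' : ∀ z w, g.SameCycle z w → c z = c w := fun z w h => by
      have : Quotient.mk (SameCycle.setoid g) z = Quotient.mk _ w := Quotient.sound h
      simp only [c, this]
    refine ⟨fun z => if g.SameCycle p z then p else c z, if_pos (SameCycle.refl g p), fun z => ?_,
      fun z w h => ?_⟩
    · dsimp only
      split_ifs with h
      exacts [h, hc z]
    · dsimp only
      rw [hc' z w h]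
      congr 1
      exact propext ⟨fun h' => h'.trans h, fun h' => h'.trans h.symm⟩
  obtain ⟨b, hbp, hb1, hb2⟩ := hb
  choose k hk using hb1
  let h : α → α := fun z => (g ^ (-k z)) (b z)
  have hh : ∀ z (l : ℤ), (g ^ l) (b z) = z → h z = (g ^ (-l)) (b z) := fun z l hl => by
    have h1 : (g ^ (k z)) (b z) = (g ^ l) (b z) := (hk z).trans hl.symm
    have h2 : (g ^ (-l)) ((g ^ (-k z)) ((g ^ (k z)) (b z))) =
      (g ^ (-l)) ((g ^ (-k z)) ((g ^ l) (b z))) := by rw [h1]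
    simp only [← mul_apply, ← zpow_add] at h2
    simp only [h]
    convert h2.symm using 3 <;> abel_nf
  have hinvol : Function.Involutive h := fun z => by
    have hbz : b (h z) = b z :=
      (hb2 _ _ (SameCycle.symm ⟨-k z, rfl⟩)).trans (hb2 _ _ ⟨k z, hk z⟩)
    rw [hh (h z) (-k z) (by rw [hbz]), hbz, neg_neg, hk]
  refine ⟨hinvol.toPerm, ?_, ?_⟩
  · have := hh p 0 (by simp [hbp])
    simpa [hbp] using this
  · rw [mul_inv_eq_iff_eq_mul]
    ext z
    have hbz : b (g z) = b z := (hb2 _ _ ⟨1, by simp⟩).symm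
    have := hh (g z) (1 + k z) (by rw [hbz, zpow_add, mul_apply, hk, zpow_one])
    simp only [mul_apply, Function.Involutive.coe_toPerm]
    rw [this, hbz, neg_add, zpow_add, mul_apply, zpow_neg_one]

theorem invariantFormsSymm_fin (n : ℕ) : Representation.InvariantFormsSymm (Perm (Fin n)) := by
  induction n with
  | zero => exact Representation.invariantFormsSymm_of_subsingleton _
  | succ n ih =>
    let ι : Perm (Fin n) →* Perm (Fin (n + 1)) :=
      { toFun σ := finSuccEquivLast.symm.permCongr (optionCongr σ)
        map_one' := by ext; simp
        map_mul' σ τ := by ext x; cases x using Fin.lastCases <;> simp }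
    refine ih.of_hom ι fun g => ?_
    obtain ⟨h, hh, hg⟩ := exists_conj_eq_inv_of_fixed g (Fin.last n)
    refine ⟨removeNone (finSuccEquivLast.permCongr h), ?_⟩
    have : ι (removeNone (finSuccEquivLast.permCongr h)) = h := by
      have h0 : ∀ e : Perm (Option (Fin n)), e none = none → optionCongr (removeNone e) = e := by
        intro e he
        have := map_equiv_removeNone e
        rw [he, swap_self] at this
        exact this.trans (one_mul e)
      simp only [ι, MonoidHom.coe_mk, OneHom.coe_mk]
      rw [h0 _ (by simp [hh])]
      ext; simp
    rw [this, hg]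

end Equiv.Perm

theorem numSqrt_mulEquiv {G H : Type*} [Group G] [Group H] (e : G ≃* H) (g : G) :
    numSqrt (e g) = numSqrt g :=
  Nat.card_congr (e.toEquiv.subtypeEquiv fun x => by
    rw [MulEquiv.toEquiv_eq_coe, MulEquiv.coe_toEquiv, ← map_pow, e.injective.eq_iff]).symm

namespace Equiv.Perm

variable {α : Type*}

/-- The complement of the cycles of `p` and `y`. -/
def OffCycles (g : Perm α) (p y a : α) : Prop :=
  ¬ g.SameCycle p a ∧ ¬ g.SameCycle y a

theorem offCycles_apply_iff (g : Perm α) (p y a : α) :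
    g.OffCycles p y (g a) ↔ g.OffCycles p y a := by
  simp only [OffCycles, sameCycle_apply_right]

section SquareRoot

variable {g x : Perm α} {p y : α}

theorem zpow_apply_of_sq_eq (hx : x ^ 2 = g) (hxp : x p = y) (k : ℤ) :
    x ((g ^ k) p) = (g ^ k) y ∧ x ((g ^ k) y) = (g ^ (k + 1)) p := by
  subst hx hxp
  have h : Commute x ((x ^ 2) ^ k) := ((Commute.refl x).pow_right 2).zpow_right k
  have h' := congrArg (fun σ : Perm α => σ p) h.eq
  have h'' := congrArg (fun σ : Perm α => σ (x p)) h.eq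
  refine ⟨h', h''.trans ?_⟩
  rw [zpow_add, zpow_one, pow_two x]
  rfl

theorem offCycles_apply_iff_of_sq_eq (hx : x ^ 2 = g) (hxp : x p = y) (a : α) :
    g.OffCycles p y (x a) ↔ g.OffCycles p y a := by
  have key : ∀ a, g.SameCycle p a ∨ g.SameCycle y a →
      g.SameCycle p (x a) ∨ g.SameCycle y (x a) := by
    rintro a (⟨k, rfl⟩ | ⟨k, rfl⟩)
    · exact Or.inr ⟨k, (zpow_apply_of_sq_eq hx hxp k).1.symm⟩
    · exact Or.inl ⟨k + 1, (zpow_apply_of_sq_eq hx hxp k).2.symm⟩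
  have hxx : x (x a) = g a := by rw [← hx, pow_two]; rfl
  have h1 := key a
  have h2 := key (x a)
  rw [hxx, sameCycle_apply_right, sameCycle_apply_right] at h2
  simp only [OffCycles]
  tauto

end SquareRoot

theorem card_sqrt_apply_eq_le [Finite α] (g : Perm α) (p y : α) :
    Nat.card {x : Perm α // x ^ 2 = g ∧ x p = y} ≤
      numSqrt (g.subtypePerm (p := g.OffCycles p y) (g.offCycles_apply_iff p y)) := by
  refine Nat.card_le_card_of_injective (fun x => ⟨x.1.subtypePerm
    (offCycles_apply_iff_of_sq_eq x.2.1 x.2.2), ?_⟩) ?_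
  · ext a
    simp only [subtypePerm_pow, subtypePerm_apply, x.2.1]
  · rintro ⟨x, hx, hxp⟩ ⟨z, hz, hzp⟩ h
    refine Subtype.ext (Equiv.ext fun a => ?_)
    dsimp only
    by_cases ha : g.OffCycles p y a
    · have := congrArg (fun σ : {σ : Perm {a // g.OffCycles p y a} // _} =>
        (σ.1 ⟨a, ha⟩ : α)) h
      exact this
    · have : g.SameCycle p a ∨ g.SameCycle y a := by
        simp only [OffCycles] at ha
        tauto
      rcases this with ⟨k, rfl⟩ | ⟨k, rfl⟩
      · rw [(zpow_apply_of_sq_eq hx hxp k).1, (zpow_apply_of_sq_eq hz hzp k).1]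
      · rw [(zpow_apply_of_sq_eq hx hxp k).2, (zpow_apply_of_sq_eq hz hzp k).2]

variable [Fintype α] [DecidableEq α]

theorem numSqrt_eq_sum (g : Perm α) (p : α) :
    numSqrt g = ∑ y, Nat.card {x : Perm α // x ^ 2 = g ∧ x p = y} := by
  simp only [numSqrt, Nat.card_eq_fintype_card, Fintype.card_subtype]
  rw [Finset.card_eq_sum_card_fiberwise (f := fun x : Perm α => x p) (t := Finset.univ)
    fun _ _ => Finset.mem_coe.2 (Finset.mem_univ _)]
  simp only [Finset.filter_filter]

/-- A square root of `g` preserving the cycle of `p` acts on it as a determined power of `g`. -/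
theorem odd_card_and_eq_of_sq_eq {g x : Perm α} {p y : α} (hx : x ^ 2 = g) (hxp : x p = y)
    (hp : g p ≠ p) (hy : g.SameCycle p y) :
    Odd (g.cycleOf p).support.card ∧ y = (g ^ ((g.cycleOf p).support.card / 2 + 1)) p := by
  obtain ⟨k, rfl⟩ := hy
  set j := (g.cycleOf p).support.card
  have hper : ∀ l : ℤ, (g ^ l) p = p ↔ (j : ℤ) ∣ l := fun l =>
     (isCycleOn_support_cycleOf g p).zpow_apply_eq
      ((mem_support_cycleOf_iff' hp).2 (SameCycle.refl g p))
  have h2 : (g ^ k) ((g ^ k) p) = g p := by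
    rw [← (zpow_apply_of_sq_eq hx hxp k).1, ← hxp, ← mul_apply, ← pow_two, hx]
  have h3 : (j : ℤ) ∣ 2 * k - 1 := by
    rw [← hper, two_mul, sub_eq_neg_add, zpow_add, zpow_add, mul_apply, mul_apply, h2]
    simp
  have hodd : Odd j := by
    obtain ⟨c, hc⟩ := h3
    have : Odd ((j : ℤ) * c) := by rw [← hc]; exact ⟨k - 1, by ring⟩
    exact_mod_cast (Int.odd_mul.1 this).1
  refine ⟨hodd, ?_⟩
  obtain ⟨t, ht⟩ := hodd
  obtain ⟨c, hc⟩ := h3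
  have h4 : (j : ℤ) ∣ -(t + 1) + k := by
    refine ⟨c * (t + 1) - k, ?_⟩
    have : (j : ℤ) = 2 * t + 1 := by exact_mod_cast ht
    rw [mul_sub, ← mul_assoc, ← hc, this]
    ring
  rw [← hper, zpow_add, mul_apply, zpow_neg, inv_eq_iff_eq] at h4
  rw [show j / 2 + 1 = t + 1 by omega, h4]
  exact_mod_cast rfl

instance (g : Perm α) (p y : α) : DecidablePred (g.OffCycles p y) := fun a =>
  inferInstanceAs (Decidable (¬ g.SameCycle p a ∧ ¬ g.SameCycle y a))

theorem cycleType_eq_add_of_offCycles {g h : Perm α} {p y : α}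
    (h1 : ∀ a, g.OffCycles p y a → h a = a) (h2 : ∀ a, ¬ g.OffCycles p y a → h a = g a) :
    g.cycleType = (g.subtypePerm (p := g.OffCycles p y) (g.offCycles_apply_iff p y)).cycleType +
      h.cycleType := by
  set t := g.subtypePerm (p := g.OffCycles p y) (g.offCycles_apply_iff p y)
  have ht : ∀ a, ¬ g.OffCycles p y a → ofSubtype t a = a := fun a ha =>
    ofSubtype_apply_of_not_mem t ha
  have hdisj : Disjoint (ofSubtype t) h := fun a => by
    by_cases ha : g.OffCycles p y a
    · exact Or.inr (h1 a ha)
    · exact Or.inl (ht a ha)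
  have hg : g = ofSubtype t * h := by
    ext a
    rw [mul_apply]
    by_cases ha : g.OffCycles p y a
    · rw [h1 a ha, ofSubtype_apply_of_mem t ha]
      rfl
    · rw [h2 a ha, ht]
      rwa [offCycles_apply_iff]
  conv_lhs => rw [hg]
  rw [hdisj.cycleType_mul, cycleType_ofSubtype]

theorem cycleType_eq_of_sameCycle {g : Perm α} {p y : α} (hp : g p ≠ p) (hy : g.SameCycle p y) :
    g.cycleType = (g.subtypePerm (p := g.OffCycles p y) (g.offCycles_apply_iff p y)).cycleType +
      {(g.cycleOf p).support.card} := by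
  rw [← (isCycle_cycleOf g hp).cycleType]
  refine cycleType_eq_add_of_offCycles (fun a ha => cycleOf_apply_of_not_sameCycle ha.1)
    fun a ha => SameCycle.cycleOf_apply ?_
  by_contra h
  exact ha ⟨h, fun h' => h (hy.trans h')⟩

theorem card_eq_of_sameCycle {g : Perm α} {p y : α} (hp : g p ≠ p) (hy : g.SameCycle p y) :
    Fintype.card α = Fintype.card {a // g.OffCycles p y a} + (g.cycleOf p).support.card := by
  rw [add_comm, Fintype.card_subtype, ← Finset.card_add_card_compl (g.cycleOf p).support]
  congr 2
  ext a
  rw [Finset.mem_compl, mem_support_cycleOf_iff' hp, Finset.mem_filter_univ, OffCycles]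
  have : g.SameCycle p a ↔ g.SameCycle y a := ⟨hy.symm.trans, hy.trans⟩
  tauto

theorem disjoint_cycleOf {g : Perm α} {p y : α} (hy : ¬ g.SameCycle p y) :
    Disjoint (g.cycleOf p) (g.cycleOf y) := fun a => by
  by_cases h : g.SameCycle p a
  · exact Or.inr (cycleOf_apply_of_not_sameCycle fun h' => hy (h.trans h'.symm))
  · exact Or.inl (cycleOf_apply_of_not_sameCycle h)

theorem cycleType_eq_of_not_sameCycle {g : Perm α} {p y : α} (hp : g p ≠ p) (hy' : g y ≠ y)
    (hy : ¬ g.SameCycle p y) :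
    g.cycleType = (g.subtypePerm (p := g.OffCycles p y) (g.offCycles_apply_iff p y)).cycleType +
      ({(g.cycleOf p).support.card} + {(g.cycleOf y).support.card}) := by
  rw [← (isCycle_cycleOf g hp).cycleType, ← (isCycle_cycleOf g hy').cycleType,
    ← (disjoint_cycleOf hy).cycleType_mul]
  refine cycleType_eq_add_of_offCycles (fun a ha => ?_) fun a ha => ?_
  · rw [mul_apply, cycleOf_apply_of_not_sameCycle ha.2, cycleOf_apply_of_not_sameCycle ha.1]
  · rw [mul_apply]
    by_cases h : g.SameCycle y a
    · rw [h.cycleOf_apply, cycleOf_apply_of_not_sameCycle fun h' =>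
        hy (h'.trans (sameCycle_apply_right.2 h).symm)]
    · rw [cycleOf_apply_of_not_sameCycle h, SameCycle.cycleOf_apply]
      by_contra h'
      exact ha ⟨h', h⟩

theorem card_eq_of_not_sameCycle {g : Perm α} {p y : α} (hp : g p ≠ p) (hy' : g y ≠ y)
    (hy : ¬ g.SameCycle p y) :
    Fintype.card α = Fintype.card {a // g.OffCycles p y a} +
      ((g.cycleOf p).support.card + (g.cycleOf y).support.card) := by
  rw [add_comm, Fintype.card_subtype, ← Finset.card_union_of_disjoint
    (disjoint_iff_disjoint_support.1 (disjoint_cycleOf hy)),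
    ← Finset.card_add_card_compl ((g.cycleOf p).support ∪ (g.cycleOf y).support)]
  congr 2
  ext a
  rw [Finset.mem_compl, Finset.mem_union, mem_support_cycleOf_iff' hp, mem_support_cycleOf_iff' hy',
    Finset.mem_filter_univ, OffCycles, not_or]

theorem card_support_cycleOf_eq_of_sq_eq {g x : Perm α} {p y : α} (hx : x ^ 2 = g) (hxp : x p = y)
    (hp : g p ≠ p) : g y ≠ y ∧ (g.cycleOf y).support.card = (g.cycleOf p).support.card := by
  have hy : g y ≠ y := fun h => hp (x.injective (by
    rw [hxp, ← mul_apply]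
    subst hx
    rw [← pow_succ', pow_succ, mul_apply, hxp, h]))
  refine ⟨hy, (Finset.card_bij (fun a _ => x a) ?_ (fun a _ b _ h => x.injective h) ?_).symm⟩
  · intro a ha
    rw [mem_support_cycleOf_iff' hp] at ha
    obtain ⟨k, rfl⟩ := ha
    rw [mem_support_cycleOf_iff' hy, (zpow_apply_of_sq_eq hx hxp k).1]
    exact ⟨k, rfl⟩
  · intro b hb
    rw [mem_support_cycleOf_iff' hy] at hb
    obtain ⟨k, rfl⟩ := hb
    exact ⟨(g ^ k) p, (mem_support_cycleOf_iff' hp).2 ⟨k, rfl⟩, (zpow_apply_of_sq_eq hx hxp k).1⟩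

open Classical in
/-- The number of square roots of a permutation of `n` points with cycle type `m`; zero if there is
no such permutation. -/
noncomputable def sqrtCount (n : ℕ) (m : Multiset ℕ) : ℕ :=
  if h : ∃ g : Perm (Fin n), g.cycleType = m then numSqrt h.choose else 0

theorem cycleType_permCongr {β : Type*} [Fintype β] [DecidableEq β] (e : α ≃ β) (g : Perm α) :
    (e.permCongr g).cycleType = g.cycleType := by
  rw [← cycleType_extendDomain (e.trans (subtypeUnivEquiv (p := fun _ : β => True)
    fun _ => trivial).symm)]
  congr 1

theorem numSqrt_eq_sqrtCount (g : Perm α) :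
    numSqrt g = sqrtCount (Fintype.card α) g.cycleType := by
  let e := Fintype.equivFin α
  have h : ∃ g' : Perm (Fin (Fintype.card α)), g'.cycleType = g.cycleType :=
    ⟨e.permCongr g, cycleType_permCongr e g⟩
  rw [sqrtCount, dif_pos h]
  have hc := h.choose_spec.trans (cycleType_permCongr e g).symm
  rw [ ← isConj_iff_cycleType_eq, isConj_iff] at hc
  obtain ⟨c, hc⟩ := hc
  rw [← numSqrt_conj h.choose c, hc, ← numSqrt_mulEquiv e.permCongrHom g]
  rfl

theorem numSqrt_le_of_apply_ne {g : Perm α} {p : α} (hp : g p ≠ p) {n j : ℕ}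
    (hn : Fintype.card α = n) (hj : (g.cycleOf p).support.card = j) :
    numSqrt g ≤ (if Odd j then sqrtCount (n - j) (g.cycleType - {j}) else 0) +
      (n - j) * (if {j} + {j} ≤ g.cycleType then
        sqrtCount (n - 2 * j) (g.cycleType - ({j} + {j})) else 0) := by
  subst hn hj
  rw [numSqrt_eq_sum g p, ← Finset.sum_add_sum_compl (g.cycleOf p).support]
  refine add_le_add ?_ ?_
  · set A := if Odd (g.cycleOf p).support.card then _ else 0 with hA
    set q := (g ^ ((g.cycleOf p).support.card / 2 + 1)) p
    trans ∑ y ∈ (g.cycleOf p).support, if y = q then A else 0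
    · refine Finset.sum_le_sum fun y hy => ?_
      rw [mem_support_cycleOf_iff' hp] at hy
      rcases isEmpty_or_nonempty {x : Perm α // x ^ 2 = g ∧ x p = y} with he | ⟨x, hx, hxp⟩
      · rw [Nat.card_of_isEmpty]
        exact Nat.zero_le _
      · obtain ⟨hodd, hyp⟩ := odd_card_and_eq_of_sq_eq hx hxp hp hy
        refine (card_sqrt_apply_eq_le g p y).trans ?_
        rw [if_pos hyp, hA, if_pos hodd, numSqrt_eq_sqrtCount, card_eq_of_sameCycle hp hy,
          cycleType_eq_of_sameCycle hp hy, Nat.add_sub_cancel, add_tsub_cancel_right]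
    · rw [Finset.sum_ite_eq']
      split_ifs
      exacts [le_rfl, Nat.zero_le _]
  · rw [← Finset.card_compl, ← smul_eq_mul]
    refine Finset.sum_le_card_nsmul _ _ _ fun y hy => ?_
    rw [Finset.mem_compl, mem_support_cycleOf_iff' hp] at hy
    rcases isEmpty_or_nonempty {x : Perm α // x ^ 2 = g ∧ x p = y} with he | ⟨x, hx, hxp⟩
    · rw [Nat.card_of_isEmpty]
      exact Nat.zero_le _
    · obtain ⟨hy', hcard⟩ := card_support_cycleOf_eq_of_sq_eq hx hxp hp
      have h1 := cycleType_eq_of_not_sameCycle hp hy' hy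
      have h2 := card_eq_of_not_sameCycle hp hy' hy
      rw [hcard] at h1 h2
      refine (card_sqrt_apply_eq_le g p y).trans ?_
      rw [if_pos (by rw [h1]; exact le_add_self), numSqrt_eq_sqrtCount, h2, h1, two_mul,
        Nat.add_sub_cancel, add_tsub_cancel_right]

/-- The cycle types of permutations of `n` points. -/
def cycleTypes (n : ℕ) : Finset (Multiset ℕ) :=
  Finset.univ.image fun g : Perm (Fin n) => g.cycleType

/-- The sum of the numbers of square roots over the conjugacy classes of `Perm (Fin n)`. -/
noncomputable def sqrtTotal (n : ℕ) : ℕ :=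
  ∑ m ∈ cycleTypes n, sqrtCount n m

theorem sqrtCount_zero_right (n : ℕ) : sqrtCount n 0 = numInvolutions n := by
  have := numSqrt_eq_sqrtCount (1 : Perm (Fin n))
  rw [cycleType_one, Fintype.card_fin] at this
  exact this.symm

theorem sum_sqrtCount_le_sqrtTotal (n : ℕ) {A : Finset (Multiset ℕ)} {t : Multiset ℕ}
    (hA : ∀ m ∈ A, t ≤ m) : ∑ m ∈ A, sqrtCount n (m - t) ≤ sqrtTotal n := by
  rw [← Finset.sum_image (f := sqrtCount n) (g := fun m => m - t) fun m hm m' hm' h =>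
    (tsub_left_inj (hA m hm) (hA m' hm')).1 h]
  refine Finset.sum_le_sum_of_ne_zero fun m _ hm => ?_
  rw [sqrtCount] at hm
  split_ifs at hm with h
  · obtain ⟨g, hg⟩ := h
    exact Finset.mem_image.2 ⟨g, Finset.mem_univ g, hg⟩
  · exact absurd rfl hm

/-- The contribution to `sqrtTotal n` of the classes with a distinguished cycle of length `j`. -/
noncomputable def cycleTerm (n j : ℕ) : ℕ :=
  (if 3 ≤ j ∧ Odd j then sqrtTotal (n - j) else 0) +
    if 2 ≤ j ∧ 2 * j ≤ n then (n - j) * sqrtTotal (n - 2 * j) else 0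

theorem exists_mem_sqrtCount_le {n : ℕ} {m : Multiset ℕ} (hm : m ∈ cycleTypes n) (hm0 : m ≠ 0) :
    ∃ j ∈ m, 2 ≤ j ∧ j ≤ n ∧ sqrtCount n m ≤ (if Odd j then sqrtCount (n - j) (m - {j}) else 0) +
      (n - j) * if {j} + {j} ≤ m then sqrtCount (n - 2 * j) (m - ({j} + {j})) else 0 := by
  obtain ⟨g, -, rfl⟩ := Finset.mem_image.1 hm
  obtain ⟨p, hp⟩ : ∃ p, g p ≠ p := by
    by_contra! h
    exact hm0 (cycleType_eq_zero.2 (Equiv.ext h))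
  have h := numSqrt_le_of_apply_ne hp (Fintype.card_fin n) rfl
  rw [numSqrt_eq_sqrtCount, Fintype.card_fin] at h
  refine ⟨_, ?_, two_le_card_support_cycleOf_iff.2 hp, ?_, h⟩
  · rw [cycleType_eq_of_sameCycle hp (SameCycle.refl g p)]
    simp
  · exact (Finset.card_le_univ _).trans_eq (Fintype.card_fin n)

theorem sqrtTotal_le (n : ℕ) :
    sqrtTotal n ≤ numInvolutions n + ∑ j ∈ Finset.range (n + 1), cycleTerm n j := by
  have h0 : (0 : Multiset ℕ) ∈ cycleTypes n :=
    Finset.mem_image.2 ⟨1, Finset.mem_univ _, cycleType_one⟩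
  rw [sqrtTotal, ← Finset.add_sum_erase _ _ h0, sqrtCount_zero_right]
  gcongr
  have hex : ∀ m ∈ (cycleTypes n).erase 0, _ := fun m hm =>
    exists_mem_sqrtCount_le (Finset.mem_of_mem_erase hm) (Finset.ne_of_mem_erase hm)
  choose! c hcm hc2 hcn hc using hex
  rw [← Finset.sum_fiberwise_of_maps_to (t := Finset.range (n + 1)) (g := c) fun m hm =>
    Finset.mem_range_succ_iff.2 (hcn m hm)]
  refine Finset.sum_le_sum fun j _ => ?_
  set A := ((cycleTypes n).erase 0).filter fun m => c m = j with hA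
  have hAc : ∀ m ∈ A, m ∈ (cycleTypes n).erase 0 ∧ c m = j := fun m hm => Finset.mem_filter.1 hm
  refine (Finset.sum_le_sum fun m hm => (hAc m hm).2 ▸ hc m (hAc m hm).1).trans ?_
  rw [Finset.sum_add_distrib, cycleTerm]
  rcases A.eq_empty_or_nonempty with hAe | ⟨m₀, hm₀⟩
  · simp [hAe]
  have hj : 2 ≤ j := (hAc m₀ hm₀).2 ▸ hc2 m₀ (hAc m₀ hm₀).1
  refine add_le_add ?_ ?_
  · by_cases hodd : Odd j
    · have h3 : 3 ≤ j := by
        obtain ⟨k, rfl⟩ := hodd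
        omega
      simp only [if_pos hodd, if_pos (And.intro h3 hodd)]
      refine sum_sqrtCount_le_sqrtTotal _ fun m hm => ?_
      rw [Multiset.singleton_le, ← (hAc m hm).2]
      exact hcm m (hAc m hm).1
    · simp [hodd]
  · rw [← Finset.mul_sum, ← Finset.sum_filter]
    split_ifs with h
    · gcongr
      exact sum_sqrtCount_le_sqrtTotal _ fun m hm => (Finset.mem_filter.1 hm).2
    · rw [Finset.filter_false_of_mem, Finset.sum_empty, mul_zero]
      intro m hm hle
      obtain ⟨g, -, rfl⟩ := Finset.mem_image.1 (Finset.mem_of_mem_erase (hAc m hm).1)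
      obtain ⟨t, ht⟩ := Multiset.le_iff_exists_add.1 hle
      have := sum_cycleType_le g
      rw [ht, Fintype.card_fin] at this
      simp only [Multiset.sum_add, Multiset.sum_singleton] at this
      omega

theorem sum_cycleTerm_add_two_le (n : ℕ) :
    ∑ j ∈ Finset.range (n + 3), cycleTerm (n + 2) j ≤
      sqrtTotal (n - 1) + n * sqrtTotal (n - 2) +
        2 * ∑ j ∈ Finset.range (n + 1), cycleTerm n j := by
  simp only [cycleTerm, Finset.sum_add_distrib]
  have h1 : ∑ j ∈ Finset.range (n + 3), (if 3 ≤ j ∧ Odd j then sqrtTotal (n + 2 - j) else 0) ≤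
      sqrtTotal (n - 1) +
        ∑ j ∈ Finset.range (n + 1), if 3 ≤ j ∧ Odd j then sqrtTotal (n - j) else 0 := by
    rw [Finset.sum_range_succ', Finset.sum_range_succ', if_neg (by omega), if_neg (by omega),
      add_zero, add_zero]
    calc _ ≤ ∑ j ∈ Finset.range (n + 1), ((if j = 1 then sqrtTotal (n - 1) else 0) +
          if 3 ≤ j ∧ Odd j then sqrtTotal (n - j) else 0) := by
          refine Finset.sum_le_sum fun j _ => ?_
          rw [show n + 2 - (j + 1 + 1) = n - j by omega]
          have hodd : Odd (j + 1 + 1) ↔ Odd j := by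
            rw [add_assoc, Nat.odd_add]
            simp
          simp only [hodd]
          by_cases hj : j = 1
          · subst hj
            simp
          · by_cases ho : Odd j
            · have : 3 ≤ j := by
                obtain ⟨k, rfl⟩ := ho
                omega
              simp [ho, this, hj, show 1 ≤ j by omega]
            · simp [ho]
      _ ≤ _ := by
          rw [Finset.sum_add_distrib, Finset.sum_ite_eq']
          gcongr
          split_ifs
          exacts [le_rfl, Nat.zero_le _]
  have h2 : ∑ j ∈ Finset.range (n + 3),
        (if 2 ≤ j ∧ 2 * j ≤ n + 2 then (n + 2 - j) * sqrtTotal (n + 2 - 2 * j) else 0) ≤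
      n * sqrtTotal (n - 2) + 2 * ∑ j ∈ Finset.range (n + 1),
        if 2 ≤ j ∧ 2 * j ≤ n then (n - j) * sqrtTotal (n - 2 * j) else 0 := by
    rw [Finset.sum_range_succ', if_neg (by omega), add_zero, Finset.sum_range_succ,
      if_neg (by omega), add_zero]
    calc _ ≤ ∑ j ∈ Finset.range (n + 1), ((if j = 1 then n * sqrtTotal (n - 2) else 0) +
          2 * if 2 ≤ j ∧ 2 * j ≤ n then (n - j) * sqrtTotal (n - 2 * j) else 0) := by
          refine Finset.sum_le_sum fun j _ => ?_
          rw [show n + 2 - 2 * (j + 1) = n - 2 * j by omega]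
          by_cases hj : 2 ≤ j ∧ 2 * j ≤ n
          · rw [if_pos (by omega), if_pos hj, ← mul_assoc]
            refine le_add_left (Nat.mul_le_mul_right _ ?_)
            omega
          · split_ifs with h h' <;> try omega
            subst h'
            rw [mul_one]
            exact le_add_right (Nat.mul_le_mul_right _ (by omega))
      _ ≤ _ := by
          rw [Finset.sum_add_distrib, Finset.sum_ite_eq', Finset.mul_sum]
          gcongr
          split_ifs
          exacts [le_rfl, Nat.zero_le _]
  omega

theorem numInvolutions_add_le (n : ℕ) :
    numInvolutions (n + 1) + (n + 1) * numInvolutions n ≤ numInvolutions (n + 2) := by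
  have hcard : ∀ {β : Type} [Fintype β] [DecidableEq β],
      numInvolutions (Fintype.card β) = numSqrt (1 : Perm β) := by
    intro β _ _
    rw [numSqrt_eq_sqrtCount, cycleType_one, sqrtCount_zero_right]
  have key : ∀ y : Fin (n + 2), numInvolutions (Fintype.card {a : Fin (n + 2) // a ≠ 0 ∧ a ≠ y}) ≤
      Nat.card {x : Perm (Fin (n + 2)) // x ^ 2 = 1 ∧ x 0 = y} := by
    intro y
    rw [hcard]
    have hfix : ∀ σ : Perm {a : Fin (n + 2) // a ≠ 0 ∧ a ≠ y}, ofSubtype σ 0 = 0 ∧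
        ofSubtype σ y = y := fun σ =>
      ⟨ofSubtype_apply_of_not_mem σ (by simp), ofSubtype_apply_of_not_mem σ (by simp)⟩
    refine Nat.card_le_card_of_injective (fun σ => ⟨swap 0 y * ofSubtype σ.1, ?_, ?_⟩) ?_
    · have hcomm : Commute (swap 0 y) (ofSubtype σ.1) := by
        have := mul_swap_eq_swap_mul (ofSubtype σ.1) 0 y
        rw [(hfix _).1, (hfix _).2] at this
        exact this.symm
      rw [hcomm.mul_pow, ← map_pow, σ.2, map_one, mul_one, pow_two, swap_mul_self]
    · rw [mul_apply, (hfix _).1, swap_apply_left]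
    · rintro σ τ h
      exact Subtype.ext (ofSubtype_injective (mul_left_cancel (congrArg Subtype.val h)))
  have hsum : numInvolutions (n + 2) = _ := numSqrt_eq_sum (1 : Perm (Fin (n + 2))) 0
  rw [hsum, Fin.sum_univ_succ]
  refine add_le_add ((le_of_eq ?_).trans (key 0)) ?_
  · congr 1
    simp [Fintype.card_subtype_compl]
  · refine (le_of_eq ?_).trans (Finset.sum_le_sum fun i _ => key i.succ)
    rw [Finset.sum_congr rfl (g := fun _ => numInvolutions n)]
    · simp
    · intro i _
      congr 1
      rw [Fintype.card_subtype]
      have : Finset.univ.filter (fun a : Fin (n + 2) => a ≠ 0 ∧ a ≠ i.succ) = {0, i.succ}ᶜ := by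
        ext a
        simp
      rw [this, Finset.card_compl, Finset.card_pair (Fin.succ_ne_zero i).symm]
      simp

theorem sqrtTotal_le_add_numInvolutions (n : ℕ) :
    sqrtTotal n ≤ numInvolutions n + numInvolutions (n - 1) := by
  have i0 : numInvolutions 0 = 1 := by
    rw [numInvolutions, Nat.card_eq_fintype_card]; decide
  have i1 : numInvolutions 1 = 1 := by
    rw [numInvolutions, Nat.card_eq_fintype_card]; decide
  have i2 := numInvolutions_add_le 0
  have i3 := numInvolutions_add_le 1
  have i4 := numInvolutions_add_le 2
  have i2' : numInvolutions 2 = 2 := by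
    rw [numInvolutions, Nat.card_eq_fintype_card]; decide
  have T0 : cycleTerm 0 0 = 0 := by simp [cycleTerm]
  have T1 : ∑ j ∈ Finset.range 2, cycleTerm 1 j = 0 := by
    simp [Finset.sum_range_succ, cycleTerm]
  have T2 : ∑ j ∈ Finset.range 3, cycleTerm 2 j = 0 := by
    simp [Finset.sum_range_succ, cycleTerm]
  have T3 := sum_cycleTerm_add_two_le 1
  have T4 := sum_cycleTerm_add_two_le 2
  have T5 := sum_cycleTerm_add_two_le 3
  have s0 := sqrtTotal_le 0
  have s1 := sqrtTotal_le 1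
  have s2 := sqrtTotal_le 2
  norm_num [T0, T1, T2, i0, i1, i2'] at i2 i3 i4 T3 T4 T5 s0 s1 s2
  have main : ∀ n, ∑ j ∈ Finset.range (n + 1), cycleTerm n j ≤ numInvolutions (n - 1) := by
    intro n
    induction n using Nat.strong_induction_on with
    | _ n ih =>
      have hs : ∀ k < n, sqrtTotal k ≤ numInvolutions k + numInvolutions (k - 1) := fun k hk =>
        (sqrtTotal_le k).trans (Nat.add_le_add_left (ih k hk) _)
      rcases lt_or_ge n 6 with h | h
      · interval_cases n <;> norm_num [T0, T1, T2, i0, i1, i2'] <;> omega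
      · obtain ⟨k, rfl⟩ := Nat.exists_eq_add_of_le' h
        have hT := sum_cycleTerm_add_two_le (k + 4)
        have hih := ih (k + 4) (by omega)
        have h1 := hs (k + 3) (by omega)
        have h2 := hs (k + 2) (by omega)
        have r1 := numInvolutions_add_le (k + 1)
        have r2 := numInvolutions_add_le (k + 2)
        have r3 := numInvolutions_add_le (k + 3)
        simp only [Nat.reduceSubDiff, Nat.reduceAdd, add_assoc] at *
        generalize numInvolutions (k + 1) = a at *
        generalize numInvolutions (k + 2) = b at *
        generalize numInvolutions (k + 3) = c at *
        nlinarith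
  exact (sqrtTotal_le n).trans (Nat.add_le_add_left (main n) _)

end Equiv.Perm

theorem Equiv.Perm.sum_numSqrt_out (n : ℕ) [Fintype (ConjClasses (Equiv.Perm (Fin n)))] :
    ∑ C : ConjClasses (Equiv.Perm (Fin n)), numSqrt (Quotient.out C) = sqrtTotal n := by
  have hout : ∀ C : ConjClasses (Equiv.Perm (Fin n)), ConjClasses.mk (Quotient.out C) = C :=
    fun C => Quotient.out_eq C
  refine Finset.sum_bij (fun C _ => (Quotient.out C).cycleType)
    (fun C _ => Finset.mem_image_of_mem _ (Finset.mem_univ _)) (fun C _ D _ h => ?_)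
    (fun m hm => ?_) fun C _ => ?_
  · rw [← hout C, ← hout D]
    exact ConjClasses.mk_eq_mk_iff_isConj.2 (isConj_iff_cycleType_eq.2 h)
  · obtain ⟨g, -, rfl⟩ := Finset.mem_image.1 hm
    exact ⟨ConjClasses.mk g, Finset.mem_univ _,
      isConj_iff_cycleType_eq.1 (ConjClasses.mk_eq_mk_iff_isConj.1 (hout _))⟩
  · rw [numSqrt_eq_sqrtCount, Fintype.card_fin]

theorem IsIrrFamily.tableSum_eq_sqrtTotal {n : ℕ} {S : Finset (Equiv.Perm (Fin n) → ℂ)}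
    (hS : IsIrrFamily (Equiv.Perm (Fin n)) S) :
    tableSum (Equiv.Perm (Fin n)) S = Equiv.Perm.sqrtTotal n := by
  have hinv : ∀ g : Equiv.Perm (Fin n), ∃ k, k * g * k⁻¹ = g⁻¹ := fun g => by
    cases n with
    | zero => exact ⟨1, Subsingleton.elim _ _⟩
    | succ n =>
      obtain ⟨k, -, hk⟩ := Equiv.Perm.exists_conj_eq_inv_of_fixed g 0
      exact ⟨k, hk⟩
  have := Fintype.ofFinite (ConjClasses (Equiv.Perm (Fin n)))
  simp only [tableSum, finsum_eq_sum_of_fintype]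
  rw [Finset.sum_comm, ← Equiv.Perm.sum_numSqrt_out, Nat.cast_sum]
  exact Finset.sum_congr rfl fun C _ =>
    hS.sum_apply (Equiv.Perm.invariantFormsSymm_fin n) hinv (Quotient.out C)

theorem numInvolutions_le_succ (n : ℕ) : numInvolutions n ≤ numInvolutions (n + 1) := by
  cases n with
  | zero =>
    rw [numInvolutions, numInvolutions, Nat.card_eq_fintype_card, Nat.card_eq_fintype_card]
    decide
  | succ n => exact (Nat.le_add_right _ _).trans (Equiv.Perm.numInvolutions_add_le n)

/-- For `n ≥ 4`, the character table sum `s_n` of `S_n` satisfies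
`s_n ≤ i_n + i_{n-1}`, and consequently `s_n ≤ 2 i_n`, i.e. the character table
sum is at most twice the character degree sum. -/
theorem tableSum_symmetric_le (n : ℕ) (hn : 4 ≤ n)
    (S : Finset (Equiv.Perm (Fin n) → ℂ)) (hS : IsIrrFamily (Equiv.Perm (Fin n)) S) :
    tableSum (Equiv.Perm (Fin n)) S ≤
        (numInvolutions n : ℂ) + (numInvolutions (n - 1) : ℂ) ∧
    tableSum (Equiv.Perm (Fin n)) S ≤ 2 * (numInvolutions n : ℂ) := by
  have h1 := Equiv.Perm.sqrtTotal_le_add_numInvolutions n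
  have h2 := numInvolutions_le_succ (n - 1)
  rw [Nat.sub_add_cancel (by omega)] at h2
  rw [hS.tableSum_eq_sqrtTotal]
  refine ⟨by exact_mod_cast h1, ?_⟩
  have h3 : Equiv.Perm.sqrtTotal n ≤ 2 * numInvolutions n := by omega
  exact_mod_cast h3
end
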